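/- arXiv:2210.00654 — 2 statements merged into one kernel-verified Lean document; each statement's English description precedes it below -/
import Mathlib

section
/- (Strong soundness of the product-free fragment.) If a product-free sequent Π → B is derivable from a set H of product-free sequents in L^Λ_{\,/}(∧,0,1), then Π → B is true in every product-free non-standard square R-model in which all sequents of H are true. -/
/-- Product-free formulae: built from variables and the constants 0 and 1 using
`\` (left division), `/` (right division) and `∧` (intersection). -/
inductive Fm where
  | var : ℕ → Fm                -- propositional variable
  | zero : Fm                   -- constant 0
  | one : Fm                    -- constant 1
  | ldiv : Fm → Fm → Fm         -- left division A\B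
  | rdiv : Fm → Fm → Fm         -- right division B/A
  | inter : Fm → Fm → Fm        -- intersection A∧B

/-- Derivability from hypotheses `H` in the product-free calculus `L^Λ_{\,/}(∧,0,1)`. -/
inductive Deriv (H : Set (List Fm × Fm)) : List Fm → Fm → Prop
  | hyp {P B} : (P, B) ∈ H → Deriv H P B
  | id (A) : Deriv H [A] A
  | oneR : Deriv H [] Fm.one
  | zeroL (Γ Δ C) : Deriv H (Γ ++ [Fm.zero] ++ Δ) C
  | cut {P A Γ Δ C} : Deriv H P A → Deriv H (Γ ++ [A] ++ Δ) C →
      Deriv H (Γ ++ P ++ Δ) C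
  | ldivL {P A Γ B Δ C} : Deriv H P A → Deriv H (Γ ++ [B] ++ Δ) C →
      Deriv H (Γ ++ P ++ [Fm.ldiv A B] ++ Δ) C
  | ldivR {P A B} : Deriv H (A :: P) B → Deriv H P (Fm.ldiv A B)
  | rdivL {P A Γ B Δ C} : Deriv H P A → Deriv H (Γ ++ [B] ++ Δ) C →
      Deriv H (Γ ++ [Fm.rdiv B A] ++ P ++ Δ) C
  | rdivR {P A B} : Deriv H (P ++ [A]) B → Deriv H P (Fm.rdiv B A)
  | andL1 {Γ A B Δ C} : Deriv H (Γ ++ [A] ++ Δ) C →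
      Deriv H (Γ ++ [Fm.inter A B] ++ Δ) C
  | andL2 {Γ A B Δ C} : Deriv H (Γ ++ [B] ++ Δ) C →
      Deriv H (Γ ++ [Fm.inter A B] ++ Δ) C
  | andR {P A B} : Deriv H P A → Deriv H P B → Deriv H P (Fm.inter A B)
  | oneL {Γ Δ C} : Deriv H (Γ ++ Δ) C → Deriv H (Γ ++ [Fm.one] ++ Δ) C

/-- Relational composition of binary relations on `W`. -/
def rcomp {W : Type} (R S : Set (W × W)) : Set (W × W) :=
  {p | ∃ y, (p.1, y) ∈ R ∧ (y, p.2) ∈ S}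

/-- Left residual `R \ S`. -/
def lres {W : Type} (R S : Set (W × W)) : Set (W × W) :=
  {p | ∀ x, (x, p.1) ∈ R → (x, p.2) ∈ S}

/-- Right residual `S / R`. -/
def rres {W : Type} (S R : Set (W × W)) : Set (W × W) :=
  {p | ∀ z, (p.2, z) ∈ R → (p.1, z) ∈ S}

/-- The diagonal relation `δ`. -/
def diag {W : Type} : Set (W × W) := {p | p.1 = p.2}

/-- A product-free non-standard square R-model over a (non-empty) set `W`: the family
`𝔄` is closed under `\`, `/`, `∩` but not necessarily under composition. -/
structure PFModel (W : Type) where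
  famA : Set (Set (W × W))
  unit : Set (W × W)
  zero : Set (W × W)
  v : Fm → Set (W × W)
  closed_lres : ∀ R ∈ famA, ∀ S ∈ famA, lres R S ∈ famA
  closed_rres : ∀ S ∈ famA, ∀ R ∈ famA, rres S R ∈ famA
  closed_inter : ∀ R ∈ famA, ∀ S ∈ famA, R ∩ S ∈ famA
  unit_mem : unit ∈ famA
  zero_mem : zero ∈ famA
  unit_comp : ∀ R ∈ famA, rcomp unit R = R
  comp_unit : ∀ R ∈ famA, rcomp R unit = R
  zero_least : ∀ R ∈ famA, zero ⊆ R
  v_mem : ∀ A, v A ∈ famA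
  v_ldiv : ∀ A B, v (Fm.ldiv A B) = lres (v A) (v B)
  v_rdiv : ∀ B A, v (Fm.rdiv B A) = rres (v B) (v A)
  v_inter : ∀ A B, v (Fm.inter A B) = v A ∩ v B
  v_one : v Fm.one = unit
  v_zero : v Fm.zero = zero

/-- Interpretation of an antecedent: `v(A₁)∘…∘v(Aₙ)`, with `δ` for the empty list. -/
def PFModel.vList {W : Type} (M : PFModel W) : List Fm → Set (W × W)
  | [] => diag
  | A :: Γ => rcomp (M.v A) (M.vList Γ)

/-- Truth of a sequent in a product-free non-standard square R-model. -/
def PFModel.seqTrue {W : Type} (M : PFModel W) (s : List Fm × Fm) : Prop :=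
  M.vList s.1 ⊆ M.v s.2

theorem PFModel.mem_vList_append {W : Type} (M : PFModel W) (Γ Δ : List Fm) (x z : W) :
    (x, z) ∈ M.vList (Γ ++ Δ) ↔ ∃ y, (x, y) ∈ M.vList Γ ∧ (y, z) ∈ M.vList Δ := by
  induction Γ generalizing x with
  | nil => simp [PFModel.vList, diag]
  | cons A Γ ih =>
    simp only [List.cons_append, PFModel.vList, rcomp, Set.mem_ofPred_eq, ih]
    constructor
    · rintro ⟨u, hu, y, hy, hz⟩
      exact ⟨y, ⟨u, hu, hy⟩, hz⟩
    · rintro ⟨y, ⟨u, hu, hy⟩, hz⟩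
      exact ⟨u, hu, y, hy, hz⟩

theorem PFModel.mem_vList_singleton {W : Type} (M : PFModel W) (A : Fm) (x y : W) :
    (x, y) ∈ M.vList [A] ↔ (x, y) ∈ M.v A := by
  simp [PFModel.vList, rcomp, diag]

/-- The diagonal lies below the unit, since `1 \ 1 = 1 ∘ (1 \ 1) ⊆ 1`. -/
theorem PFModel.diag_subset_unit {W : Type} (M : PFModel W) : diag ⊆ M.unit := by
  rintro ⟨x, y⟩ hxy
  obtain rfl : x = y := hxy
  have hx : (x, x) ∈ lres M.unit M.unit := fun _ hz => hz
  rw [← M.unit_comp _ (M.closed_lres _ M.unit_mem _ M.unit_mem)] at hx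
  obtain ⟨y, hxy, hyx⟩ := hx
  exact hyx x hxy

theorem PFModel.mem_of_mem_zero_of_mem_vList {W : Type} (M : PFModel W) (Δ : List Fm) (C : Fm)
    {x y z : W} (hxy : (x, y) ∈ M.zero) (hyz : (y, z) ∈ M.vList Δ) : (x, z) ∈ M.v C := by
  induction Δ using List.reverseRecOn generalizing C z with
  | nil =>
    obtain rfl : y = z := hyz
    exact M.zero_least _ (M.v_mem C) hxy
  | append_singleton Δ D ih =>
    obtain ⟨u, hu, huz⟩ := (M.mem_vList_append _ _ _ _).1 hyz
    have h := ih (Fm.rdiv C D) hu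
    rw [M.v_rdiv] at h
    exact h z ((M.mem_vList_singleton _ _ _).1 huz)

theorem PFModel.mem_of_mem_vList_of_mem_zero {W : Type} (M : PFModel W) (Γ Δ : List Fm) (C : Fm)
    {w x y z : W} (hwx : (w, x) ∈ M.vList Γ) (hxy : (x, y) ∈ M.zero)
    (hyz : (y, z) ∈ M.vList Δ) : (w, z) ∈ M.v C := by
  induction Γ generalizing C w with
  | nil =>
    obtain rfl : w = x := hwx
    exact M.mem_of_mem_zero_of_mem_vList Δ C hxy hyz
  | cons A Γ ih =>
    obtain ⟨u, hu, hux⟩ := hwx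
    have h := ih (Fm.ldiv A C) hux
    rw [M.v_ldiv] at h
    exact h w hu

theorem PFModel.mem_of_mem_unit {W : Type} (M : PFModel W) (Γ Δ : List Fm) (C : Fm)
    (h : M.vList (Γ ++ Δ) ⊆ M.v C) {w x y z : W} (hwx : (w, x) ∈ M.vList Γ)
    (hxy : (x, y) ∈ M.unit) (hyz : (y, z) ∈ M.vList Δ) : (w, z) ∈ M.v C := by
  rcases List.eq_nil_or_concat' Γ with rfl | ⟨Γ, A, rfl⟩
  · obtain rfl : w = x := hwx
    cases Δ with
    | nil =>
      obtain rfl : y = z := hyz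
      rw [← M.unit_comp _ (M.v_mem C)]
      exact ⟨y, hxy, h (rfl : y = y)⟩
    | cons D Δ =>
      obtain ⟨u, hu, huz⟩ := hyz
      have hD : (w, u) ∈ M.v D := by
        rw [← M.unit_comp _ (M.v_mem D)]
        exact ⟨y, hxy, hu⟩
      exact h ⟨u, hD, huz⟩
  · obtain ⟨u, hu, hux⟩ := (M.mem_vList_append _ _ _ _).1 hwx
    rw [M.mem_vList_singleton] at hux
    have hA : (u, y) ∈ M.v A := by
      rw [← M.comp_unit _ (M.v_mem A)]
      exact ⟨x, hux, hxy⟩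
    refine h ((M.mem_vList_append _ _ _ _).2 ⟨y, (M.mem_vList_append _ _ _ _).2 ⟨u, hu, ?_⟩, hyz⟩)
    exact (M.mem_vList_singleton _ _ _).2 hA

theorem PFModel.seqTrue_append_iff {W : Type} (M : PFModel W) (Γ Ξ Δ : List Fm) (C : Fm) :
    M.seqTrue (Γ ++ Ξ ++ Δ, C) ↔ ∀ w x y z, (w, x) ∈ M.vList Γ → (x, y) ∈ M.vList Ξ →
      (y, z) ∈ M.vList Δ → (w, z) ∈ M.v C := by
  constructor
  · intro h w x y z hwx hxy hyz
    exact h ((M.mem_vList_append _ _ _ _).2 ⟨y, (M.mem_vList_append _ _ _ _).2 ⟨x, hwx, hxy⟩, hyz⟩)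
  · rintro h ⟨w, z⟩ hwz
    obtain ⟨y, hwy, hyz⟩ := (M.mem_vList_append _ _ _ _).1 hwz
    obtain ⟨x, hwx, hxy⟩ := (M.mem_vList_append _ _ _ _).1 hwy
    exact h w x y z hwx hxy hyz

/-- Strong soundness of the product-free fragment: if a product-free sequent `Π → B`
is derivable from a set `H` of product-free sequents in `L^Λ_{\,/}(∧,0,1)`, then it is
true in every product-free non-standard square R-model in which all sequents of `H`
are true. -/
theorem strong_soundness_product_free (H : Set (List Fm × Fm)) (P : List Fm) (B : Fm)
    (h : Deriv H P B) :
    ∀ (W : Type) [Nonempty W] (M : PFModel W),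
      (∀ s ∈ H, M.seqTrue s) → M.seqTrue (P, B) := by
  intro W _ M hH
  induction h with
  | hyp h => exact hH _ h
  | id A => exact fun ⟨x, y⟩ h => (M.mem_vList_singleton A x y).1 h
  | oneR => exact fun _ h => M.v_one ▸ M.diag_subset_unit h
  | zeroL Γ Δ C =>
    rw [M.seqTrue_append_iff]
    intro w x y z hwx hxy hyz
    rw [M.mem_vList_singleton, M.v_zero] at hxy
    exact M.mem_of_mem_vList_of_mem_zero Γ Δ C hwx hxy hyz
  | cut _ _ ih₁ ih₂ =>
    rw [M.seqTrue_append_iff] at ih₂ ⊢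
    intro w x y z hwx hxy hyz
    exact ih₂ w x y z hwx ((M.mem_vList_singleton _ _ _).2 (ih₁ hxy)) hyz
  | ldivL _ _ ih₁ ih₂ =>
    rw [M.seqTrue_append_iff] at ih₂ ⊢
    intro w x y z hwx hxy hyz
    obtain ⟨u, hwu, hux⟩ := (M.mem_vList_append _ _ _ _).1 hwx
    rw [M.mem_vList_singleton, M.v_ldiv] at hxy
    exact ih₂ w u y z hwu ((M.mem_vList_singleton _ _ _).2 (hxy u (ih₁ hux))) hyz
  | ldivR _ ih =>
    rintro ⟨x, y⟩ hxy
    rw [M.v_ldiv]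
    exact fun u hu => ih ⟨x, hu, hxy⟩
  | rdivL _ _ ih₁ ih₂ =>
    rw [List.append_assoc, M.seqTrue_append_iff]
    rw [M.seqTrue_append_iff] at ih₂
    intro w x y z hwx hxy hyz
    obtain ⟨u, hyu, huz⟩ := (M.mem_vList_append _ _ _ _).1 hyz
    rw [M.mem_vList_singleton, M.v_rdiv] at hxy
    exact ih₂ w x u z hwx ((M.mem_vList_singleton _ _ _).2 (hxy u (ih₁ hyu))) huz
  | rdivR _ ih =>
    rintro ⟨x, y⟩ hxy
    rw [M.v_rdiv]
    exact fun u hu =>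
      ih ((M.mem_vList_append _ _ _ _).2 ⟨y, hxy, (M.mem_vList_singleton _ _ _).2 hu⟩)
  | andL1 _ ih =>
    rw [M.seqTrue_append_iff] at ih ⊢
    intro w x y z hwx hxy hyz
    rw [M.mem_vList_singleton, M.v_inter] at hxy
    exact ih w x y z hwx ((M.mem_vList_singleton _ _ _).2 hxy.1) hyz
  | andL2 _ ih =>
    rw [M.seqTrue_append_iff] at ih ⊢
    intro w x y z hwx hxy hyz
    rw [M.mem_vList_singleton, M.v_inter] at hxy
    exact ih w x y z hwx ((M.mem_vList_singleton _ _ _).2 hxy.2) hyz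
  | andR _ _ ih₁ ih₂ =>
    intro p hp
    rw [M.v_inter]
    exact ⟨ih₁ hp, ih₂ hp⟩
  | @oneL Γ Δ C _ ih =>
    rw [M.seqTrue_append_iff]
    intro w x y z hwx hxy hyz
    rw [M.mem_vList_singleton, M.v_one] at hxy
    exact M.mem_of_mem_unit Γ Δ C ih hwx hxy hyz
end

section
/- (Strong completeness of the product-free fragment.) If a product-free sequent Π → B semantically follows from a set H of product-free sequents over the class of product-free non-standard square R-models (i.e. Π → B is true in every such model in which all sequents of H are true), then Π → B is derivable from H in L^Λ_{\,/}(∧,0,1). -/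
namespace Fm

/-- The element of the free group on formulae given by a sequence of formulae. -/
def word (Γ : List Fm) : FreeGroup Fm := FreeGroup.mk (Γ.map fun A => (A, true))

theorem word_append (Γ Δ : List Fm) : word (Γ ++ Δ) = word Γ * word Δ := by
  simp [word]

theorem word_nil : word [] = 1 := rfl

theorem isReduced_map_true (Γ : List Fm) :
    FreeGroup.IsReduced (Γ.map fun A => (A, true)) := by
  simp only [FreeGroup.IsReduced, List.isChain_map, implies_true]
  exact (List.pairwise_of_forall fun _ _ => trivial).isChain

open Classical in
theorem toWord_word (Γ : List Fm) : (word Γ).toWord = Γ.map fun A => (A, true) := by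
  rw [word, FreeGroup.toWord_mk, (isReduced_map_true Γ).reduce_eq]

theorem word_injective : Function.Injective word := by
  classical
  intro Γ Δ h
  have h' := congrArg FreeGroup.toWord h
  rw [toWord_word, toWord_word] at h'
  exact List.map_injective_iff.2 (fun A B hAB => (Prod.mk.inj hAB).1) h'

open Classical in
theorem mem_range_word {u : FreeGroup Fm} :
    u ∈ Set.range word ↔ ∀ p ∈ u.toWord, p.2 = true := by
  constructor
  · rintro ⟨Γ, rfl⟩
    simp [toWord_word]
  · intro h
    refine ⟨u.toWord.map Prod.fst, ?_⟩
    rw [word, List.map_map]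
    have : u.toWord.map ((fun A => (A, true)) ∘ Prod.fst) = u.toWord := by
      refine (List.map_congr_left fun p hp => ?_).trans (List.map_id _)
      exact Prod.ext rfl (h p hp).symm
    rw [this, FreeGroup.mk_toWord]

theorem exists_var_notMem (o : Option (Fm × Bool)) :
    ∃ a : Fm, ∀ p ∈ o, p.1 ≠ a := by
  by_cases h : ∀ p ∈ o, p.1 ≠ var 0
  · exact ⟨_, h⟩
  · refine ⟨var 1, ?_⟩
    push Not at h
    obtain ⟨p, hp, hp0⟩ := h
    intro q hq hq1
    cases Option.mem_unique hp hq
    rw [hp0] at hq1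
    cases hq1

theorem exists_word_mul_notMem {u : FreeGroup Fm} (hu : u ∉ Set.range word) :
    ∃ a, word [zero, a] * u ∉ Set.range word := by
  classical
  obtain ⟨a, ha⟩ := exists_var_notMem u.toWord.head?
  refine ⟨a, fun h => hu ?_⟩
  have hred : FreeGroup.IsReduced ([zero, a].map (fun A => (A, true)) ++ u.toWord) := by
    refine List.isChain_append.2 ⟨isReduced_map_true _, FreeGroup.isReduced_toWord, ?_⟩
    intro p hp q hq hpq
    simp only [List.map_cons, List.map_nil, List.getLast?_cons_cons, List.getLast?_singleton,
      Option.mem_some_iff] at hp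
    exact absurd (hpq.symm.trans (by rw [← hp])) (ha q hq)
  have heq : (word [zero, a] * u).toWord = [zero, a].map (fun A => (A, true)) ++ u.toWord := by
    conv_lhs => rw [← FreeGroup.mk_toWord (x := u), word, FreeGroup.mul_mk]
    rw [FreeGroup.toWord_mk, hred.reduce_eq]
  rw [mem_range_word, heq] at h
  exact mem_range_word.2 fun p hp => h p (List.mem_append_right _ hp)

theorem exists_mul_word_notMem {u : FreeGroup Fm} (hu : u ∉ Set.range word) :
    ∃ a, u * word [a, zero] ∉ Set.range word := by
  classical
  obtain ⟨a, ha⟩ := exists_var_notMem u.toWord.getLast?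
  refine ⟨a, fun h => hu ?_⟩
  have hred : FreeGroup.IsReduced (u.toWord ++ [a, zero].map (fun A => (A, true))) := by
    refine List.isChain_append.2 ⟨FreeGroup.isReduced_toWord, isReduced_map_true _, ?_⟩
    intro p hp q hq hpq
    simp only [List.map_cons, List.head?_cons, Option.mem_some_iff] at hq
    exact absurd (hpq.trans (by rw [← hq])) (ha p hp)
  have heq : (u * word [a, zero]).toWord = u.toWord ++ [a, zero].map (fun A => (A, true)) := by
    conv_lhs => rw [← FreeGroup.mk_toWord (x := u), word, FreeGroup.mul_mk]
    rw [FreeGroup.toWord_mk, hred.reduce_eq]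
  rw [mem_range_word, heq] at h
  exact mem_range_word.2 fun p hp => h p (List.mem_append_left _ hp)

end Fm

namespace Deriv

variable {H : Set (List Fm × Fm)} {Γ Δ : List Fm} {A B C : Fm}

theorem ldiv_mp (hA : Deriv H Δ A) (h : Deriv H Γ (Fm.ldiv A B)) : Deriv H (Δ ++ Γ) B := by
  have h₁ : Deriv H (Δ ++ [Fm.ldiv A B] ++ []) B := ldivL (Γ := []) (Δ := []) hA (id B)
  simpa using cut h h₁

theorem rdiv_mp (h : Deriv H Γ (Fm.rdiv B A)) (hA : Deriv H Δ A) : Deriv H (Γ ++ Δ) B := by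
  have h₁ : Deriv H ([] ++ [Fm.rdiv B A] ++ Δ ++ []) B := rdivL (Γ := []) (Δ := []) hA (id B)
  simpa using cut (Γ := []) (Δ := Δ) h (by simpa using h₁)

theorem inter_left (h : Deriv H Γ (Fm.inter A B)) : Deriv H Γ A := by
  simpa using cut (Γ := []) (Δ := []) h (andL1 (id A))

theorem inter_right (h : Deriv H Γ (Fm.inter A B)) : Deriv H Γ B := by
  simpa using cut (Γ := []) (Δ := []) h (andL2 (id B))

theorem of_zero_mem (h : Fm.zero ∈ Γ) (C : Fm) : Deriv H Γ C := by
  obtain ⟨Γ₁, Γ₂, rfl⟩ := List.append_of_mem h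
  simpa using zeroL (H := H) Γ₁ Γ₂ C

theorem of_zero (h : Deriv H Γ Fm.zero) (C : Fm) : Deriv H Γ C := by
  simpa using cut (Γ := []) (Δ := []) h (zeroL [] [] C)

theorem one_append (h : Deriv H Γ Fm.one) (hA : Deriv H Δ A) : Deriv H (Γ ++ Δ) A := by
  simpa using cut (Γ := []) (Δ := Δ) h (oneL (by simpa using hA))

theorem append_one (hA : Deriv H Δ A) (h : Deriv H Γ Fm.one) : Deriv H (Δ ++ Γ) A := by
  simpa using cut (Γ := Δ) (Δ := []) h (oneL (by simpa using hA))

end Deriv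

section Canonical

variable (H : Set (List Fm × Fm))

/-- The canonical valuation on the free group: `(x, y)` satisfies `A` when `y` is reached from `x`
by a sequence of formulae deriving `A`. -/
def canonicalVal (A : Fm) : Set (FreeGroup Fm × FreeGroup Fm) :=
  {p | ∃ Γ, Deriv H Γ A ∧ p.2 = p.1 * Fm.word Γ}

theorem canonicalVal_ldiv (A B : Fm) :
    canonicalVal H (Fm.ldiv A B) = lres (canonicalVal H A) (canonicalVal H B) := by
  ext ⟨y, z⟩
  constructor
  · rintro ⟨Γ, hΓ, hz⟩ x ⟨Δ, hΔ, hy⟩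
    refine ⟨Δ ++ Γ, Deriv.ldiv_mp hΔ hΓ, ?_⟩
    simp_all [Fm.word_append, mul_assoc]
  · intro h
    by_cases hyz : y⁻¹ * z ∈ Set.range Fm.word
    · obtain ⟨Γ, hΓ⟩ := hyz
      obtain ⟨Δ, hΔ, hz⟩ := h (y * (Fm.word [A])⁻¹) ⟨[A], Deriv.id A, by simp⟩
      refine ⟨Γ, Deriv.ldivR ?_, by simp [hΓ]⟩
      have : Fm.word ([A] ++ Γ) = Fm.word Δ := by
        rw [Fm.word_append, hΓ]
        simp only at hz
        rw [hz]
        group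
      rwa [← List.singleton_append, Fm.word_injective this]
    · obtain ⟨a, ha⟩ := Fm.exists_word_mul_notMem hyz
      obtain ⟨Δ, -, hz⟩ := h (y * (Fm.word [Fm.zero, a])⁻¹)
        ⟨[Fm.zero, a], Deriv.of_zero_mem (by simp) A, by simp⟩
      refine absurd ⟨Δ, ?_⟩ ha
      simp only at hz
      rw [hz]
      group

theorem canonicalVal_rdiv (B A : Fm) :
    canonicalVal H (Fm.rdiv B A) = rres (canonicalVal H B) (canonicalVal H A) := by
  ext ⟨x, y⟩
  constructor
  · rintro ⟨Γ, hΓ, hy⟩ z ⟨Δ, hΔ, hz⟩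
    refine ⟨Γ ++ Δ, Deriv.rdiv_mp hΓ hΔ, ?_⟩
    simp_all [Fm.word_append, mul_assoc]
  · intro h
    by_cases hxy : x⁻¹ * y ∈ Set.range Fm.word
    · obtain ⟨Γ, hΓ⟩ := hxy
      obtain ⟨Δ, hΔ, hz⟩ := h (y * Fm.word [A]) ⟨[A], Deriv.id A, rfl⟩
      refine ⟨Γ, Deriv.rdivR ?_, by simp [hΓ]⟩
      have : Fm.word (Γ ++ [A]) = Fm.word Δ := by
        rw [Fm.word_append, hΓ, mul_assoc]
        simp only at hz
        rw [hz]
        group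
      rwa [Fm.word_injective this]
    · obtain ⟨a, ha⟩ := Fm.exists_mul_word_notMem hxy
      obtain ⟨Δ, -, hz⟩ := h (y * Fm.word [a, Fm.zero])
        ⟨[a, Fm.zero], Deriv.of_zero_mem (by simp) A, rfl⟩
      refine absurd ⟨Δ, ?_⟩ ha
      simp only at hz
      rw [mul_assoc, hz]
      group

theorem canonicalVal_inter (A B : Fm) :
    canonicalVal H (Fm.inter A B) = canonicalVal H A ∩ canonicalVal H B := by
  ext ⟨x, y⟩
  constructor
  · rintro ⟨Γ, hΓ, h⟩
    exact ⟨⟨Γ, hΓ.inter_left, h⟩, ⟨Γ, hΓ.inter_right, h⟩⟩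
  · rintro ⟨⟨Γ, hΓ, h⟩, ⟨Δ, hΔ, h'⟩⟩
    obtain rfl := Fm.word_injective (mul_left_cancel (h.symm.trans h'))
    exact ⟨Γ, Deriv.andR hΓ hΔ, h⟩

/-- The canonical model of the hypotheses `H`, with the free group on formulae as base set. -/
def canonicalModel : PFModel (FreeGroup Fm) where
  famA := Set.range (canonicalVal H)
  unit := canonicalVal H Fm.one
  zero := canonicalVal H Fm.zero
  v := canonicalVal H
  closed_lres := by
    rintro _ ⟨A, rfl⟩ _ ⟨B, rfl⟩
    exact ⟨_, canonicalVal_ldiv H A B⟩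
  closed_rres := by
    rintro _ ⟨B, rfl⟩ _ ⟨A, rfl⟩
    exact ⟨_, canonicalVal_rdiv H B A⟩
  closed_inter := by
    rintro _ ⟨A, rfl⟩ _ ⟨B, rfl⟩
    exact ⟨_, canonicalVal_inter H A B⟩
  unit_mem := ⟨_, rfl⟩
  zero_mem := ⟨_, rfl⟩
  unit_comp := by
    rintro _ ⟨A, rfl⟩
    ext ⟨x, z⟩
    constructor
    · rintro ⟨y, ⟨Γ, hΓ, hy⟩, ⟨Δ, hΔ, hz⟩⟩
      exact ⟨Γ ++ Δ, hΓ.one_append hΔ, by simp_all [Fm.word_append, mul_assoc]⟩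
    · exact fun h => ⟨x, ⟨[], Deriv.oneR, by simp [Fm.word_nil]⟩, h⟩
  comp_unit := by
    rintro _ ⟨A, rfl⟩
    ext ⟨x, z⟩
    constructor
    · rintro ⟨y, ⟨Γ, hΓ, hy⟩, ⟨Δ, hΔ, hz⟩⟩
      exact ⟨Γ ++ Δ, hΓ.append_one hΔ, by simp_all [Fm.word_append, mul_assoc]⟩
    · exact fun h => ⟨z, h, ⟨[], Deriv.oneR, by simp [Fm.word_nil]⟩⟩
  zero_least := by
    rintro _ ⟨A, rfl⟩ _ ⟨Γ, hΓ, h⟩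
    exact ⟨Γ, hΓ.of_zero A, h⟩
  v_mem A := ⟨A, rfl⟩
  v_ldiv := canonicalVal_ldiv H
  v_rdiv := canonicalVal_rdiv H
  v_inter := canonicalVal_inter H
  v_one := rfl
  v_zero := rfl

variable {H}

theorem exists_word_of_mem_vList {Γ : List Fm} {x y : FreeGroup Fm}
    (h : (x, y) ∈ (canonicalModel H).vList Γ) :
    ∃ Δ, y = x * Fm.word Δ ∧
      ∀ Θ C, Deriv H (Θ ++ Γ) C → Deriv H (Θ ++ Δ) C := by
  induction Γ generalizing x with
  | nil =>
    obtain rfl : x = y := h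
    exact ⟨[], by simp [Fm.word_nil], fun _ _ => _root_.id⟩
  | cons A Γ ih =>
    obtain ⟨z, ⟨Δ₁, hΔ₁, hz⟩, hy⟩ := h
    obtain ⟨Δ₂, hΔ₂, hcut⟩ := ih hy
    refine ⟨Δ₁ ++ Δ₂, by simp_all [Fm.word_append, mul_assoc], fun Θ C hC => ?_⟩
    rw [← List.append_assoc]
    exact hcut _ _ (Deriv.cut hΔ₁ (by simpa using hC))

theorem canonicalModel_seqTrue_of_deriv {Γ : List Fm} {C : Fm} (h : Deriv H Γ C) :
    (canonicalModel H).seqTrue (Γ, C) := by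
  rintro ⟨x, y⟩ hxy
  obtain ⟨Δ, hΔ, hcut⟩ := exists_word_of_mem_vList hxy
  exact ⟨Δ, hcut [] C h, hΔ⟩

theorem mem_vList_canonicalModel (Γ : List Fm) (x : FreeGroup Fm) :
    (x, x * Fm.word Γ) ∈ (canonicalModel H).vList Γ := by
  induction Γ generalizing x with
  | nil => simp [PFModel.vList, diag, Fm.word_nil]
  | cons A Γ ih =>
    refine ⟨x * Fm.word [A], ⟨[A], Deriv.id A, rfl⟩, ?_⟩
    simpa [← Fm.word_append, mul_assoc] using ih (x * Fm.word [A])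

theorem deriv_of_canonicalModel_seqTrue {Γ : List Fm} {C : Fm}
    (h : (canonicalModel H).seqTrue (Γ, C)) : Deriv H Γ C := by
  obtain ⟨Δ, hΔ, heq⟩ := h (mem_vList_canonicalModel Γ 1)
  rwa [Fm.word_injective (mul_left_cancel heq)]

end Canonical

/-- Strong completeness of the product-free fragment: if a product-free sequent
`Π → B` is true in every product-free non-standard square R-model in which all
sequents of `H` are true, then `Π → B` is derivable from `H` in `L^Λ_{\,/}(∧,0,1)`. -/
theorem strong_completeness_product_free (H : Set (List Fm × Fm)) (P : List Fm) (B : Fm)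
    (h : ∀ (W : Type) [Nonempty W] (M : PFModel W),
      (∀ s ∈ H, M.seqTrue s) → M.seqTrue (P, B)) :
    Deriv H P B := by
  exact deriv_of_canonicalModel_seqTrue <| h _ (canonicalModel H)
    fun _ hs => canonicalModel_seqTrue_of_deriv (Deriv.hyp hs)
end
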